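/- For a random variable X taking values in a finite alphabet and any γ ≥ 0, the relaxed Wyner's common information of X with itself equals C_γ(X;X) = max{ H(X) − γ, 0 }, where H(X) is the Shannon entropy of X. -/

import Mathlib

open scoped BigOperators
open Classical

noncomputable section

/-- `p` is a probability mass function on the finite alphabet `α`. -/
def IsPMF {α : Type*} [Fintype α] (p : α → ℝ) : Prop :=
  (∀ a, 0 ≤ p a) ∧ ∑ a, p a = 1

/-- Pushforward of a pmf under a map (distribution of `f(X)` when `X ~ p`). -/
noncomputable def pmfMap {α β : Type*} [Fintype α] (f : α → β) (p : α → ℝ) : β → ℝ :=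
  fun b => ∑ a, if f a = b then p a else 0

/-- Shannon entropy (in nats) of a pmf on a finite alphabet. -/
noncomputable def Hent {α : Type*} [Fintype α] (p : α → ℝ) : ℝ :=
  ∑ a, Real.negMulLog (p a)

/-- Mutual information `I(X;Y)` of a joint pmf `p` of the pair `(X,Y)`. -/
noncomputable def mi {α β : Type*} [Fintype α] [Fintype β] (p : α × β → ℝ) : ℝ :=
  Hent (pmfMap Prod.fst p) + Hent (pmfMap Prod.snd p) - Hent p

/-- Mutual information `I(X,Y;W)` of a joint pmf `q` of the triple `((X,Y),W)`. -/
noncomputable def miW {α β W : Type*} [Fintype α] [Fintype β] [Fintype W]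
    (q : (α × β) × W → ℝ) : ℝ :=
  Hent (pmfMap Prod.fst q) + Hent (pmfMap Prod.snd q) - Hent q

/-- Conditional mutual information `I(X;Y|W)` of a joint pmf `q` of `((X,Y),W)`,
written as `H(X,W) + H(Y,W) - H(W) - H(X,Y,W)`. -/
noncomputable def cmi {α β W : Type*} [Fintype α] [Fintype β] [Fintype W]
    (q : (α × β) × W → ℝ) : ℝ :=
  Hent (pmfMap (fun x => (x.1.1, x.2)) q) + Hent (pmfMap (fun x => (x.1.2, x.2)) q)
    - Hent (pmfMap Prod.snd q) - Hent q

/-- The set of values `I(X,Y;W)` over all finite-alphabet `W` jointly distributed with `(X,Y)`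
(i.e. over all conditional distributions `p(w|x,y)`) such that `I(X;Y|W) ≤ γ`. -/
def relaxedSet {α β : Type*} [Fintype α] [Fintype β] (p : α × β → ℝ) (γ : ℝ) : Set ℝ :=
  { c | ∃ (m : ℕ) (q : (α × β) × Fin m → ℝ), IsPMF q ∧
      (pmfMap Prod.fst q = p) ∧ cmi q ≤ γ ∧ c = miW q }

/-- Relaxed Wyner's common information `C_γ(X;Y)` of a joint pmf `p` of `(X,Y)`. -/
noncomputable def Cgamma {α β : Type*} [Fintype α] [Fintype β] (p : α × β → ℝ) (γ : ℝ) : ℝ :=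
  sInf (relaxedSet p γ)

/-- Wyner's common information `C(X;Y)`: infimum of `I(X,Y;W)` over all finite-alphabet `W`
rendering `X` and `Y` conditionally independent, i.e. `I(X;Y|W) = 0`. -/
noncomputable def WynerCI {α β : Type*} [Fintype α] [Fintype β] (p : α × β → ℝ) : ℝ :=
  sInf { c | ∃ (m : ℕ) (q : (α × β) × Fin m → ℝ), IsPMF q ∧
      (pmfMap Prod.fst q = p) ∧ cmi q = 0 ∧ c = miW q }

end

section Pushforward

variable {α β δ : Type*} [Fintype α] [Fintype β]

lemma pmfMap_pmfMap (g : β → δ) (f : α → β) (p : α → ℝ) :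
    pmfMap g (pmfMap f p) = pmfMap (fun a => g (f a)) p := by
  funext d
  have h : ∀ b, (if g b = d then ∑ a, (if f a = b then p a else 0) else 0)
      = ∑ a, if f a = b then (if g (f a) = d then p a else 0) else 0 := by
    intro b
    split_ifs with hb
    · refine Finset.sum_congr rfl fun a _ => ?_
      by_cases ha : f a = b
      · simp [ha, hb]
      · simp [ha]
    · symm
      refine Finset.sum_eq_zero fun a _ => ?_
      by_cases ha : f a = b
      · simp [ha, hb]
      · simp [ha]
  simp only [pmfMap, h]
  rw [Finset.sum_comm]
  simp

lemma pmfMap_id (p : α → ℝ) : pmfMap (fun a => a) p = p := by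
  funext a
  simp [pmfMap]

lemma pmfMap_apply_of_injective {f : α → δ} (hf : Function.Injective f) (p : α → ℝ) (a : α) :
    pmfMap f p (f a) = p a := by
  simp [pmfMap, hf.eq_iff]

lemma pmfMap_eq_zero_of_notMem_range {f : α → δ} {b : δ} (hb : b ∉ Set.range f) (p : α → ℝ) :
    pmfMap f p b = 0 :=
  Finset.sum_eq_zero fun a _ => if_neg fun h => hb ⟨a, h⟩

lemma sum_pmfMap (f : α → β) (p : α → ℝ) : ∑ b, pmfMap f p b = ∑ a, p a := by
  simp only [pmfMap]
  rw [Finset.sum_comm]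
  simp

lemma pmfMap_fst_apply (r : α × β → ℝ) (a : α) : pmfMap Prod.fst r a = ∑ w, r (a, w) := by
  simp only [pmfMap, Fintype.sum_prod_type]
  rw [Finset.sum_eq_single a] <;> simp +contextual

lemma pmfMap_snd_apply (r : α × β → ℝ) (w : β) : pmfMap Prod.snd r w = ∑ a, r (a, w) := by
  simp [pmfMap, Fintype.sum_prod_type]

lemma IsPMF.map {p : α → ℝ} (hp : IsPMF p) (f : α → β) : IsPMF (pmfMap f p) := by
  refine ⟨fun b => Finset.sum_nonneg fun a _ => ?_, (sum_pmfMap f p).trans hp.2⟩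
  split_ifs
  exacts [hp.1 a, le_rfl]

lemma Hent_pmfMap_of_injective {f : α → β} (hf : Function.Injective f) (p : α → ℝ) :
    Hent (pmfMap f p) = Hent p := by
  refine (Fintype.sum_of_injective f hf _ _ (fun b hb => ?_) fun a => ?_).symm
  · rw [pmfMap_eq_zero_of_notMem_range hb, Real.negMulLog_zero]
  · rw [pmfMap_apply_of_injective hf]

lemma IsPMF.Hent_nonneg {p : α → ℝ} (hp : IsPMF p) : 0 ≤ Hent p :=
  Finset.sum_nonneg fun a _ => Real.negMulLog_nonneg (hp.1 a) <|
    hp.2 ▸ Finset.single_le_sum (fun b _ => hp.1 b) (Finset.mem_univ a)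

lemma negMulLog_le_of_nonneg {r u v : ℝ} (hr : 0 ≤ r) (hu : r ≤ u) (hv : r ≤ v) :
    Real.negMulLog r ≤ u * v - r - r * Real.log u - r * Real.log v := by
  rcases hr.eq_or_lt with rfl | hr
  · simpa using mul_nonneg hu hv
  have hu' := hr.trans_le hu
  have hv' := hr.trans_le hv
  have h := mul_le_mul_of_nonneg_left
    (Real.log_le_sub_one_of_pos (div_pos (mul_pos hu' hv') hr)) hr.le
  rw [Real.log_div (by positivity) hr.ne', Real.log_mul hu'.ne' hv'.ne', mul_sub_one,
    mul_div_cancel₀ _ hr.ne'] at h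
  rw [Real.negMulLog]
  linarith

/-- Subadditivity of entropy. -/
lemma IsPMF.Hent_le_add {r : α × β → ℝ} (hr : IsPMF r) :
    Hent r ≤ Hent (pmfMap Prod.fst r) + Hent (pmfMap Prod.snd r) := by
  set u := pmfMap Prod.fst r
  set v := pmfMap Prod.snd r
  have hu : ∀ a, u a = ∑ w, r (a, w) := pmfMap_fst_apply r
  have hv : ∀ w, v w = ∑ a, r (a, w) := pmfMap_snd_apply r
  have hle : Hent r ≤ ∑ a, ∑ w,
      (u a * v w - r (a, w) - r (a, w) * Real.log (u a) - r (a, w) * Real.log (v w)) := by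
    rw [Hent, Fintype.sum_prod_type]
    refine Finset.sum_le_sum fun a _ => Finset.sum_le_sum fun w _ =>
      negMulLog_le_of_nonneg (hr.1 _) ?_ ?_
    · rw [hu]
      exact Finset.single_le_sum (f := fun w => r (a, w)) (fun _ _ => hr.1 _) (Finset.mem_univ w)
    · rw [hv]
      exact Finset.single_le_sum (f := fun a => r (a, w)) (fun _ _ => hr.1 _) (Finset.mem_univ a)
  refine hle.trans_eq ?_
  have h₁ : ∑ a, ∑ w, u a * v w = 1 := by
    rw [← Finset.sum_mul_sum, (hr.map Prod.fst).2, (hr.map Prod.snd).2, one_mul]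
  have h₂ : ∑ a, ∑ w, r (a, w) = 1 := by rw [← Fintype.sum_prod_type, hr.2]
  have h₃ : ∑ a, ∑ w, r (a, w) * Real.log (u a) = -Hent u := by
    simp only [Hent, Real.negMulLog, ← Finset.sum_mul, ← hu, neg_mul, Finset.sum_neg_distrib,
      neg_neg]
  have h₄ : ∑ a, ∑ w, r (a, w) * Real.log (v w) = -Hent v := by
    rw [Finset.sum_comm]
    simp only [Hent, Real.negMulLog, ← Finset.sum_mul, ← hv, neg_mul, Finset.sum_neg_distrib,
      neg_neg]
  simp only [Finset.sum_sub_distrib, h₁, h₂, h₃, h₄]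
  ring

end Pushforward

section Diagonal

lemma diag_injective {α : Type*} : Function.Injective fun a : α => (a, a) :=
  fun _ _ h => congrArg Prod.fst h

lemma diagJoint_map_injective {α W : Type*} :
    Function.Injective fun x : α × W => ((x.1, x.1), x.2) := by
  rintro ⟨a, w⟩ ⟨b, v⟩ h
  simp_all

variable {α W : Type*} [Fintype α] [Fintype W]

lemma pmfMap_diag (p : α → ℝ) :
    pmfMap (fun a => (a, a)) p = fun ab : α × α => if ab.1 = ab.2 then p ab.1 else 0 := by
  funext ⟨a, b⟩
  by_cases h : a = b
  · subst h
    simp [pmfMap]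
  · simp only [pmfMap, Prod.mk.injEq, h, if_false]
    exact Finset.sum_eq_zero fun c _ => if_neg fun hc => h (hc.1.symm.trans hc.2)

/-- The joint law of `((X, X), W)`, where `r` is the joint law of `(X, W)`. -/
noncomputable def diagJoint (r : α × W → ℝ) : (α × α) × W → ℝ :=
  pmfMap (fun x => ((x.1, x.1), x.2)) r

lemma pmfMap_fst_diagJoint (r : α × W → ℝ) :
    pmfMap Prod.fst (diagJoint r) = pmfMap (fun a => (a, a)) (pmfMap Prod.fst r) := by
  simp only [diagJoint, pmfMap_pmfMap]

lemma miW_diagJoint (r : α × W → ℝ) :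
    miW (diagJoint r) = Hent (pmfMap Prod.fst r) + Hent (pmfMap Prod.snd r) - Hent r := by
  rw [miW, pmfMap_fst_diagJoint, Hent_pmfMap_of_injective diag_injective, diagJoint,
    Hent_pmfMap_of_injective diagJoint_map_injective, pmfMap_pmfMap]

lemma cmi_diagJoint (r : α × W → ℝ) :
    cmi (diagJoint r) = Hent r - Hent (pmfMap Prod.snd r) := by
  simp only [cmi, diagJoint, Hent_pmfMap_of_injective diagJoint_map_injective, pmfMap_pmfMap,
    Prod.mk.eta, pmfMap_id]
  ring

lemma exists_eq_diagJoint {q : (α × α) × W → ℝ} (hq : IsPMF q) {p : α → ℝ}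
    (h : pmfMap Prod.fst q = pmfMap (fun a => (a, a)) p) :
    ∃ r : α × W → ℝ, IsPMF r ∧ pmfMap Prod.fst r = p ∧ q = diagJoint r := by
  have hzero : ∀ a b w, a ≠ b → q ((a, b), w) = 0 := by
    intro a b w hab
    have h0 := congrFun h (a, b)
    have hmem : (a, b) ∉ Set.range fun c : α => (c, c) := by
      rintro ⟨c, hc⟩
      exact hab ((congrArg Prod.fst hc).symm.trans (congrArg Prod.snd hc))
    rw [pmfMap_fst_apply, pmfMap_eq_zero_of_notMem_range hmem,
      Finset.sum_eq_zero_iff_of_nonneg fun _ _ => hq.1 _] at h0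
    exact h0 w (Finset.mem_univ w)
  refine ⟨pmfMap (fun x => (x.1.1, x.2)) q, hq.map _, ?_, ?_⟩
  · have h' := congrArg (pmfMap Prod.fst) h
    simpa only [pmfMap_pmfMap, pmfMap_id] using h'
  · rw [diagJoint, pmfMap_pmfMap]
    nth_rw 1 [← pmfMap_id q]
    funext y
    refine Finset.sum_congr rfl fun ⟨⟨a, b⟩, w⟩ _ => ?_
    by_cases hab : a = b
    · subst hab
      rfl
    · simp [hzero a b w hab]

end Diagonal

section Erasure

variable {α : Type*} [Fintype α]

/-- The joint law of `X ∼ p` and its output through an erasure channel with erasure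
probability `t`. -/
noncomputable def erasureJoint (p : α → ℝ) (t : ℝ) : α × Option α → ℝ
  | (a, none) => t * p a
  | (a, some b) => if a = b then (1 - t) * p a else 0

lemma pmfMap_fst_erasureJoint (p : α → ℝ) (t : ℝ) :
    pmfMap Prod.fst (erasureJoint p t) = p := by
  funext a
  simp only [pmfMap_fst_apply, Fintype.sum_option, erasureJoint, Finset.sum_ite_eq,
    Finset.mem_univ, if_true]
  ring

lemma isPMF_erasureJoint {p : α → ℝ} (hp : IsPMF p) {t : ℝ} (h0 : 0 ≤ t) (h1 : t ≤ 1) :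
    IsPMF (erasureJoint p t) := by
  refine ⟨?_, ?_⟩
  · rintro ⟨a, _ | b⟩
    · exact mul_nonneg h0 (hp.1 a)
    · simp only [erasureJoint]
      split_ifs
      exacts [mul_nonneg (sub_nonneg.2 h1) (hp.1 a), le_rfl]
  · rw [← sum_pmfMap Prod.fst, pmfMap_fst_erasureJoint, hp.2]

lemma Hent_erasureJoint_sub {p : α → ℝ} (hp : IsPMF p) (t : ℝ) :
    Hent (erasureJoint p t) - Hent (pmfMap Prod.snd (erasureJoint p t)) = t * Hent p := by
  have hnone : ∑ a, Real.negMulLog (t * p a) = Real.negMulLog t + t * Hent p := by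
    simp only [Real.negMulLog_mul, Finset.sum_add_distrib, ← Finset.sum_mul, hp.2, one_mul, Hent,
      Finset.mul_sum]
  have hjoint : Hent (erasureJoint p t)
      = Real.negMulLog t + t * Hent p + ∑ a, Real.negMulLog ((1 - t) * p a) := by
    rw [← hnone]
    simp [Hent, Fintype.sum_prod_type, Fintype.sum_option, erasureJoint, apply_ite Real.negMulLog,
      Finset.sum_add_distrib]
  have hout : Hent (pmfMap Prod.snd (erasureJoint p t))
      = Real.negMulLog t + ∑ a, Real.negMulLog ((1 - t) * p a) := by
    simp [Hent, Fintype.sum_option, pmfMap_snd_apply, erasureJoint, ← Finset.mul_sum, hp.2]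
  rw [hjoint, hout]
  ring

end Erasure

lemma mem_relaxedSet_of_joint {α W : Type*} [Fintype α] [Fintype W] {r : α × W → ℝ}
    (hr : IsPMF r) {γ : ℝ} (hγ : Hent r - Hent (pmfMap Prod.snd r) ≤ γ) :
    Hent (pmfMap Prod.fst r) + Hent (pmfMap Prod.snd r) - Hent r ∈
      relaxedSet (pmfMap (fun a => (a, a)) (pmfMap Prod.fst r)) γ := by
  let e := Fintype.equivFin W
  let s : α × Fin (Fintype.card W) → ℝ := pmfMap (fun x => (x.1, e x.2)) r
  have hs : Hent s = Hent r := Hent_pmfMap_of_injective (by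
    rintro ⟨a, w⟩ ⟨b, v⟩ h
    simp_all) r
  have hfst : pmfMap Prod.fst s = pmfMap Prod.fst r := by simp only [s, pmfMap_pmfMap]
  have hsnd : Hent (pmfMap Prod.snd s) = Hent (pmfMap Prod.snd r) := by
    rw [← Hent_pmfMap_of_injective e.injective (pmfMap Prod.snd r)]
    simp only [s, pmfMap_pmfMap]
  refine ⟨_, diagJoint s, (hr.map _).map _, ?_, ?_, ?_⟩
  · rw [pmfMap_fst_diagJoint, hfst]
  · rwa [cmi_diagJoint, hs, hsnd]
  · rw [miW_diagJoint, hfst, hs, hsnd]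

/-- For a finite-alphabet random variable `X` and any `γ ≥ 0`,
`C_γ(X;X) = max{H(X) − γ, 0}`, where the joint pmf of `(X,X)` is supported on the diagonal. -/
theorem relaxedWyner_self
    {α : Type*} [Fintype α] (p : α → ℝ) (hp : IsPMF p) (γ : ℝ) (hγ : 0 ≤ γ) :
    Cgamma (fun ab : α × α => if ab.1 = ab.2 then p ab.1 else 0) γ = max (Hent p - γ) 0 := by
  rw [← pmfMap_diag]
  refine IsLeast.csInf_eq ⟨?_, ?_⟩
  · have hH := hp.Hent_nonneg
    set t := min γ (Hent p) / Hent p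
    have ht0 : 0 ≤ t := div_nonneg (le_min hγ hH) hH
    have ht1 : t ≤ 1 := div_le_one_of_le₀ (min_le_right _ _) hH
    have htH : t * Hent p = min γ (Hent p) := by
      refine div_mul_cancel_of_imp fun h => ?_
      rw [h, min_eq_right hγ]
    have hcond := Hent_erasureJoint_sub hp t
    rw [htH] at hcond
    have hmem := mem_relaxedSet_of_joint (isPMF_erasureJoint hp ht0 ht1)
      (hcond.trans_le (min_le_left _ _))
    rw [pmfMap_fst_erasureJoint] at hmem
    convert hmem using 1
    rw [← sub_sub_eq_add_sub, hcond, ← max_sub_sub_left, sub_self]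
  · rintro c ⟨m, q, hq, hmarg, hcmi, rfl⟩
    obtain ⟨r, hr, rfl, rfl⟩ := exists_eq_diagJoint hq hmarg
    rw [cmi_diagJoint] at hcmi
    rw [miW_diagJoint]
    exact max_le (by linarith) (by linarith [hr.Hent_le_add])
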